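/- Let F : {(ξ,η) ∈ ℂ² : ξ ≠ 0, ξη̄+1 ≠ 0} → ℂ², F(ξ,η) = (μ₁,μ₂) with μ₁ = −η + 1/ξ̄ and μ₂ = 1/(η̄ + 1/ξ). Then the pullback under F of the real symmetric 2-tensor 𝔾_μ = −i[(1+μ₁μ̄₂)^{−2} dμ₁⊗dμ̄₂ − (1+μ̄₁μ₂)^{−2} dμ̄₁⊗dμ₂] (symmetrized) equals the real symmetric 2-tensor 𝔾 = −(i/4)[ξ^{−2} dξ⊗dξ − ξ̄^{−2} dξ̄⊗dξ̄ + ξ̄² dη⊗dη − ξ² dη̄⊗dη̄]. (Here ℂ² is regarded as ℝ⁴ and the displayed complex expressions define real-valued symmetric bilinear forms on each tangent space.) -/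

import Mathlib

open ComplexConjugate Complex

/-- The change of coordinates `(ξ,η) ↦ (μ₁,μ₂)` on the space of oriented geodesics. -/
noncomputable def Fmap (p : ℂ × ℂ) : ℂ × ℂ :=
  (-p.2 + 1 / conj p.1, 1 / (conj p.2 + 1 / p.1))

/-- The symmetrized tensor
`𝔾_μ = −i[(1+μ₁μ̄₂)⁻² dμ₁⊗dμ̄₂ − (1+μ̄₁μ₂)⁻² dμ̄₁⊗dμ₂]` at `q`, evaluated on tangent
vectors `a`, `b` of `ℂ² ≅ ℝ⁴`. -/
noncomputable def GMu (q : ℂ × ℂ) (a b : ℂ × ℂ) : ℂ :=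
  -I * (((1 + q.1 * conj q.2) ^ 2)⁻¹ * (a.1 * conj b.2 + b.1 * conj a.2) / 2
    - ((1 + conj q.1 * q.2) ^ 2)⁻¹ * (conj a.1 * b.2 + conj b.1 * a.2) / 2)

/-- The tensor `𝔾 = −(i/4)(ξ⁻²dξ⊗dξ − ξ̄⁻²dξ̄⊗dξ̄ + ξ̄²dη⊗dη − ξ²dη̄⊗dη̄)` at the
point `p = (ξ,η)`, evaluated on tangent vectors `a`, `b`. -/
noncomputable def GXiEta (p : ℂ × ℂ) (a b : ℂ × ℂ) : ℂ :=
  -(I / 4) * ((p.1 ^ 2)⁻¹ * (a.1 * b.1) - ((conj p.1) ^ 2)⁻¹ * (conj a.1 * conj b.1)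
    + (conj p.1) ^ 2 * (a.2 * b.2) - p.1 ^ 2 * (conj a.2 * conj b.2))

/-- The differential of `Fmap`, evaluated on a tangent vector. -/
theorem fderiv_Fmap_apply (p : ℂ × ℂ) (h₁ : p.1 ≠ 0) (h₂ : conj p.2 + 1 / p.1 ≠ 0)
    (a : ℂ × ℂ) :
    fderiv ℝ Fmap p a =
      (-a.2 - conj a.1 / conj p.1 ^ 2,
        -(conj a.2 - a.1 / p.1 ^ 2) / (conj p.2 + 1 / p.1) ^ 2) := by
  have hfst : HasFDerivAt (fun q : ℂ × ℂ => q.1) (ContinuousLinearMap.fst ℝ ℂ ℂ) p :=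
    hasFDerivAt_fst
  have hsnd : HasFDerivAt (fun q : ℂ × ℂ => q.2) (ContinuousLinearMap.snd ℝ ℂ ℂ) p :=
    hasFDerivAt_snd
  have hcfst := conjCLE.toContinuousLinearMap.hasFDerivAt.comp p hfst
  have hcsnd := conjCLE.toContinuousLinearMap.hasFDerivAt.comp p hsnd
  have hc₁ : conj p.1 ≠ 0 := by simpa using h₁
  have h₂' : conj p.2 + p.1⁻¹ ≠ 0 := by simpa using h₂
  have hF := (hsnd.neg.add ((hasFDerivAt_inv' (𝕜 := ℝ) hc₁).comp p hcfst)).prodMk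
    ((hasFDerivAt_inv' (𝕜 := ℝ) h₂').comp p
      (hcsnd.add ((hasFDerivAt_inv' (𝕜 := ℝ) h₁).comp p hfst)))
  have hF' : HasFDerivAt Fmap _ p := hF.congr_of_eventuallyEq
    (Filter.Eventually.of_forall fun q => by simp [Fmap])
  rw [hF'.fderiv]
  ext1
  · simp
    ring
  · simp only [one_div]
    generalize conj p.2 + p.1⁻¹ = u
    simp
    ring

theorem stmt_9 :
    ∀ p : ℂ × ℂ, p.1 ≠ 0 → p.1 * conj p.2 + 1 ≠ 0 →
      ∀ a b : ℂ × ℂ,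
        GMu (Fmap p) (fderiv ℝ Fmap p a) (fderiv ℝ Fmap p b) = GXiEta p a b := by
  intro p h₁ h a b
  have h₂ : conj p.2 + 1 / p.1 ≠ 0 := by
    intro h0
    apply h
    rw [← mul_zero p.1, ← h0, mul_add, mul_one_div_cancel h₁]
  have hc₁ : conj p.1 ≠ 0 := by simpa using h₁
  have hc₂ : p.2 + 1 / conj p.1 ≠ 0 := by
    simpa using (map_ne_zero (starRingEnd ℂ)).mpr h₂
  have hq₁ : 1 + (-p.2 + 1 / conj p.1) * (1 / (p.2 + 1 / conj p.1)) =
      2 / (conj p.1 * (p.2 + 1 / conj p.1)) := by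
    rw [eq_div_iff (mul_ne_zero hc₁ hc₂), add_mul, mul_assoc,
      one_div_mul_eq_div, mul_div_assoc, div_self hc₂]
    field_simp
    ring
  have hq₂ : 1 + (-conj p.2 + 1 / p.1) * (1 / (conj p.2 + 1 / p.1)) =
      2 / (p.1 * (conj p.2 + 1 / p.1)) := by
    simpa [Complex.conj_ofNat] using congrArg conj hq₁
  rw [fderiv_Fmap_apply p h₁ h₂, fderiv_Fmap_apply p h₁ h₂]
  simp only [GMu, GXiEta, Fmap, map_add, map_sub, map_neg, map_div₀, map_pow, map_one,
    conj_conj, hq₁, hq₂]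
  generalize conj p.2 + 1 / p.1 = u at *
  generalize p.2 + 1 / conj p.1 = v at *
  field_simp
  ring
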